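/- Let V be a K-simple Kantor triple system with associated simple 5-graded Lie algebra g and grade-reversing involution σ. Then the Lie algebra of derivations of V is isomorphic to the fixed-point subalgebra {D ∈ g₀ : σ(D) = D} of σ in g₀, acting on V = g_{-1} by restriction of the adjoint action. -/

import Mathlib

/-- The triple product `(xyz) = [[x, σ(y)], z]` on a Lie algebra with involution. -/
def trip {L : Type*} [LieRing L] [LieAlgebra ℂ L]
    (σ : L →ₗ⁅ℂ⁆ L) (a b c : L) : L := ⁅⁅a, σ b⁆, c⁆

/-- Extension of derivations of the odd part of a `ℤ/2`-graded simple Lie algebra. -/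
theorem z2_ext {L : Type*} [LieRing L] [LieAlgebra ℂ L] [FiniteDimensional ℂ L]
    [LieAlgebra.IsSimple ℂ L] (P f : L →ₗ[ℂ] L)
    (hPP : ∀ x, P (P x) = P x)
    (h11 : ∀ x y, P x = x → P y = y → P ⁅x, y⁆ = 0)
    (h01 : ∀ x y, P x = 0 → P y = y → P ⁅x, y⁆ = ⁅x, y⁆)
    (hne : ∃ v, P v = v ∧ v ≠ 0)
    (hfaith : ∀ a, P a = 0 → (∀ x, P x = x → ⁅a, x⁆ = 0) → a = 0)
    (hPf : ∀ x, P (f x) = f x) (hfP : ∀ x, f (P x) = f x)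
    (H : ∀ x y z, P x = x → P y = y → P z = z →
      f ⁅⁅x, y⁆, z⁆ = ⁅⁅f x, y⁆, z⁆ + ⁅⁅x, f y⁆, z⁆ + ⁅⁅x, y⁆, f z⁆) :
    ∃ X : L, ∀ x, P x = x → f x = ⁅X, x⁆ := by
  have h10 : ∀ x y, P x = x → P y = 0 → P ⁅x, y⁆ = ⁅x, y⁆ := by
    intro x y hx hy
    rw [← lie_skew, map_neg, h01 y x hy hx]
  -- generation
  have hgen : ∀ w : L, w ∈ LieSubalgebra.lieSpan ℂ L {v : L | P v = v} := by
    have key : ∀ w ∈ LieSubalgebra.lieSpan ℂ L {v : L | P v = v}, ∀ y : L,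
        ⁅y, w⁆ ∈ LieSubalgebra.lieSpan ℂ L {v : L | P v = v} := by
      intro w hw y
      have hy1 : P y ∈ LieSubalgebra.lieSpan ℂ L {v : L | P v = v} :=
        LieSubalgebra.subset_lieSpan (hPP y)
      have hy0 : ⁅y - P y, w⁆ ∈ LieSubalgebra.lieSpan ℂ L {v : L | P v = v} := by
        induction hw using LieSubalgebra.lieSpan_induction with
        | mem x hx =>
          exact LieSubalgebra.subset_lieSpan (h01 _ _ (by simp [hPP]) hx)
        | zero => simp
        | add x z _ _ h1 h2 => rw [lie_add]; exact add_mem h1 h2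
        | smul c x _ h1 => rw [lie_smul]; exact SMulMemClass.smul_mem c h1
        | lie x z hx hz h1 h2 =>
          rw [leibniz_lie]
          exact add_mem (LieSubalgebra.lie_mem _ h1 hz) (LieSubalgebra.lie_mem _ hx h2)
      have : ⁅y, w⁆ = ⁅y - P y, w⁆ + ⁅P y, w⁆ := by rw [← add_lie]; simp
      rw [this]
      exact add_mem hy0 (LieSubalgebra.lie_mem _ hy1 hw)
    let I : LieIdeal ℂ L :=
      { (LieSubalgebra.lieSpan ℂ L {v : L | P v = v}).toSubmodule with
        lie_mem := fun {x m} hm => key m hm x }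
    rcases LieAlgebra.IsSimple.eq_bot_or_eq_top (R := ℂ) I with hI | hI
    · obtain ⟨v, hv, hv0⟩ := hne
      exfalso
      apply hv0
      have : v ∈ I := by
        change v ∈ LieSubalgebra.lieSpan ℂ L {v : L | P v = v}
        exact LieSubalgebra.subset_lieSpan hv
      rw [hI] at this
      simpa using this
    · intro w
      have : w ∈ I := by rw [hI]; trivial
      exact this
  -- the relation
  let T : L → L → Prop := fun a b => P b = f a ∧
    ∀ x, P x = x → f ⁅a, x⁆ = P (⁅b, x⁆ + ⁅a, f x⁆)
  have Tuniq : ∀ a b c, T a b → T a c → b = c := by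
    intro a b c hb hc
    rw [← sub_eq_zero]
    have h0 : P (b - c) = 0 := by rw [map_sub, hb.1, hc.1, sub_self]
    apply hfaith _ h0
    intro x hx
    rw [← h01 _ _ h0 hx]
    have := (hb.2 x hx).symm.trans (hc.2 x hx)
    rw [map_add, map_add] at this
    rw [sub_lie, map_sub, sub_eq_zero]
    exact add_right_cancel this
  have Tadd : ∀ a b a' b', T a b → T a' b' → T (a + a') (b + b') := by
    intro a b a' b' h h'
    refine ⟨by rw [map_add, map_add, h.1, h'.1], fun x hx => ?_⟩
    rw [add_lie, map_add, h.2 x hx, h'.2 x hx, ← map_add, add_lie, add_lie]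
    congr 1; abel
  have Tsmul : ∀ (c : ℂ) a b, T a b → T (c • a) (c • b) := by
    intro c a b h
    refine ⟨by rw [map_smul, map_smul, h.1], fun x hx => ?_⟩
    rw [smul_lie, map_smul, h.2 x hx, ← map_smul, smul_lie, smul_lie, smul_add]
  have Todd : ∀ x, P x = x → T x (f x) := by
    intro x hx
    refine ⟨hPf x, fun y hy => ?_⟩
    rw [← hfP, h11 x y hx hy, map_add, h11 _ _ (hPf x) hy, h11 _ _ hx (hPf y)]
    simp
  have Tlie : ∀ x a b, P x = x → T a b → T ⁅x, a⁆ (⁅f x, a⁆ + ⁅x, b⁆) := by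
    intro x a b hx h
    constructor
    · have h1 := h.2 x hx
      rw [← lie_skew x a, map_neg, h1, ← map_neg, ← lie_skew (f x) a, ← lie_skew x b]
      congr 1; abel
    · intro y hy
      obtain ⟨a0, ha0, a1, ha1, rfl⟩ : ∃ a0, P a0 = 0 ∧ ∃ a1, P a1 = a1 ∧ a = a0 + a1 :=
        ⟨a - P a, by simp [hPP], P a, hPP a, by simp⟩
      obtain ⟨b0, hb0, b1, hb1, rfl⟩ : ∃ a0, P a0 = 0 ∧ ∃ a1, P a1 = a1 ∧ b = a0 + a1 :=
        ⟨b - P b, by simp [hPP], P b, hPP b, by simp⟩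
      have hb : b1 = f a1 := by
        have := h.1
        rw [map_add, hb0, hb1, zero_add, ← hfP, map_add, ha0, ha1, zero_add] at this
        exact this
      have e1 : f ⁅⁅x, a0⁆, y⁆ = 0 := by
        rw [← hfP, h11 _ _ (h10 _ _ hx ha0) hy, map_zero]
      have e2 : P ⁅⁅f x, a0⁆, y⁆ = 0 := h11 _ _ (h10 _ _ (hPf x) ha0) hy
      have e3 : P ⁅⁅x, b0⁆, y⁆ = 0 := h11 _ _ (h10 _ _ hx hb0) hy
      have e4 : P ⁅⁅x, a0⁆, f y⁆ = 0 := h11 _ _ (h10 _ _ hx ha0) (hPf y)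
      have e5 := H x a1 y hx ha1 hy
      have e6 := congrArg P e5
      rw [hPf] at e6
      rw [hb]
      simp only [lie_add, add_lie, map_add] at e6 ⊢
      rw [e1, e2, e3, e4, e6]
      abel
  -- domain
  have hdom : ∀ a : L, ∃ b, T a b := by
    let N : Submodule ℂ L :=
      { carrier := {a | ∃ b, T a b}
        zero_mem' := ⟨0, by simp [T]⟩
        add_mem' := fun ⟨b, hb⟩ ⟨c, hc⟩ => ⟨b + c, Tadd _ _ _ _ hb hc⟩
        smul_mem' := fun c _ ⟨b, hb⟩ => ⟨c • b, Tsmul c _ _ hb⟩ }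
    have hN : ∀ y m : L, m ∈ N → ⁅y, m⁆ ∈ N := by
      intro y
      have hy := hgen y
      induction hy using LieSubalgebra.lieSpan_induction with
      | mem x hx => exact fun m ⟨b, hb⟩ => ⟨_, Tlie x m b hx hb⟩
      | zero => intro m _; simp
      | add x z _ _ h1 h2 => intro m hm; rw [add_lie]; exact add_mem (h1 m hm) (h2 m hm)
      | smul c x _ h1 => intro m hm; rw [smul_lie]; exact N.smul_mem c (h1 m hm)
      | lie x z hx hz h1 h2 =>
        intro m hm
        rw [lie_lie]
        exact sub_mem (h1 _ (h2 _ hm)) (h2 _ (h1 _ hm))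
    let I : LieIdeal ℂ L := { N with lie_mem := fun {x m} hm => hN x m hm }
    rcases LieAlgebra.IsSimple.eq_bot_or_eq_top (R := ℂ) I with hI | hI
    · obtain ⟨v, hv, hv0⟩ := hne
      exfalso
      apply hv0
      have : v ∈ I := by
        change v ∈ N
        exact ⟨_, Todd v hv⟩
      rw [hI] at this
      simpa using this
    · intro w
      have : w ∈ I := by rw [hI]; trivial
      exact this
  choose δ hδ using hdom
  have δodd : ∀ x, P x = x → δ x = f x := fun x hx => Tuniq _ _ _ (hδ x) (Todd x hx)
  let δl : L →ₗ[ℂ] L :=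
    { toFun := δ
      map_add' := fun a b => Tuniq _ _ _ (hδ _) (Tadd _ _ _ _ (hδ a) (hδ b))
      map_smul' := fun c a => Tuniq _ _ _ (hδ _) (Tsmul c _ _ (hδ a)) }
  have hder : ∀ y b : L, δl ⁅y, b⁆ = ⁅δl y, b⁆ + ⁅y, δl b⁆ := by
    intro y
    have hy := hgen y
    induction hy using LieSubalgebra.lieSpan_induction with
    | mem x hx =>
      intro b
      change δ _ = ⁅δ x, b⁆ + ⁅x, δ b⁆
      rw [δodd x hx]
      exact Tuniq _ _ _ (hδ _) (Tlie x b _ hx (hδ b))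
    | zero => intro m; simp
    | add x z _ _ h1 h2 =>
      intro m; simp only [add_lie, map_add, h1, h2]; abel
    | smul c x _ h1 => intro m; simp only [smul_lie, map_smul, h1, smul_add]
    | lie x z hx hz h1 h2 =>
      intro m
      rw [h1 z]
      simp only [lie_lie, map_sub, add_lie, h1, h2, lie_add]
      abel
  let Dr : LieDerivation ℂ L L :=
    { toLinearMap := δl
      leibniz' := fun a b => by
        rw [hder, ← lie_skew b (δl a)]; abel }
  obtain ⟨X, hX⟩ := LieDerivation.IsKilling.exists_eq_ad Dr
  refine ⟨X, fun x hx => ?_⟩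
  rw [← δodd x hx]
  have h1 : (LieDerivation.ad ℂ L X) x = δ x := by rw [hX]; rfl
  rw [← h1]
  simp

/-- Homogeneous projections of an internal grading. -/
theorem exists_pr {L : Type*} [AddCommGroup L] [Module ℂ L] (g : ℤ → Submodule ℂ L)
    (hdecomp : DirectSum.IsInternal g) :
    ∃ pr : ℤ → L →ₗ[ℂ] L, (∀ p x, pr p x ∈ g p) ∧ (∀ p, ∀ x ∈ g p, pr p x = x) ∧
      (∀ p q, p ≠ q → ∀ x ∈ g p, pr q x = 0) := by
  let e := LinearEquiv.ofBijective (DirectSum.coeLinearMap g) hdecomp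
  have he : ∀ p (x : L) (hx : x ∈ g p), e.symm x = DirectSum.lof ℂ ℤ (fun i => g i) p ⟨x, hx⟩ := by
    intro p x hx
    rw [LinearEquiv.symm_apply_eq]
    exact (DirectSum.coeLinearMap_lof g p ⟨x, hx⟩).symm
  refine ⟨fun p => (g p).subtype ∘ₗ DirectSum.component ℂ ℤ (fun i => g i) p ∘ₗ e.symm.toLinearMap,
    ?_, ?_, ?_⟩
  · intro p x
    simp
  · intro p x hx
    simp [he p x hx, DirectSum.component.lof_self]
  · intro p q hpq x hx
    simp [he p x hx, DirectSum.component.of, hpq]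

/-- For a K-simple Kantor triple system `V = g₋₁` with simple Tits-Kantor-Koecher
Lie algebra `g` and involution `σ`, the derivations of `V` are exactly the
restrictions of `ad D` for `D` in the fixed-point set of `σ` in `g₀`, and each
such `D` is unique. -/
theorem derivations_are_fixed_points_of_sigma
    {L : Type*} [LieRing L] [LieAlgebra ℂ L] [FiniteDimensional ℂ L]
    [LieAlgebra.IsSimple ℂ L]
    (g : ℤ → Submodule ℂ L)
    (hdecomp : DirectSum.IsInternal g)
    (hgrad : ∀ p q : ℤ, ∀ x ∈ g p, ∀ y ∈ g q, ⁅x, y⁆ ∈ g (p + q))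
    (hbound : ∀ p : ℤ, 2 < |p| → g p = ⊥)
    (σ : L →ₗ⁅ℂ⁆ L)
    (hσ2 : ∀ x : L, σ (σ x) = x)
    (hσg : ∀ p : ℤ, ∀ x ∈ g p, σ x ∈ g (-p))
    (htrans : ∀ p : ℤ, 0 ≤ p → ∀ D ∈ g p,
      (∀ x ∈ g (-1), ⁅D, x⁆ = 0) → D = 0)
    (hKsimple : ∀ I : Submodule ℂ L, I ≤ g (-1) →
      (∀ x ∈ g (-1), ∀ y ∈ g (-1), ∀ i ∈ I,
        trip σ x y i ∈ I ∧ trip σ i x y ∈ I) →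
      I = ⊥ ∨ I = g (-1)) :
    (∀ D ∈ g 0, σ D = D →
      (∀ x ∈ g (-1), ⁅D, x⁆ ∈ g (-1)) ∧
      (∀ x ∈ g (-1), ∀ y ∈ g (-1), ∀ z ∈ g (-1),
        ⁅D, trip σ x y z⁆
          = trip σ ⁅D, x⁆ y z + trip σ x ⁅D, y⁆ z + trip σ x y ⁅D, z⁆)) ∧
    (∀ d : L →ₗ[ℂ] L,
      (∀ x ∈ g (-1), d x ∈ g (-1)) →
      (∀ x ∈ g (-1), ∀ y ∈ g (-1), ∀ z ∈ g (-1),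
        d (trip σ x y z)
          = trip σ (d x) y z + trip σ x (d y) z + trip σ x y (d z)) →
      ∃! D : L, D ∈ g 0 ∧ σ D = D ∧ ∀ x ∈ g (-1), d x = ⁅D, x⁆) := by
  refine ⟨?_, ?_⟩
  · intro D hD hσD
    refine ⟨fun x hx => by simpa using hgrad 0 (-1) D hD x hx, ?_⟩
    intro x _ y _ z _
    unfold trip
    rw [leibniz_lie, leibniz_lie D x, LieHom.map_lie, hσD, add_lie]
  · intro d hd hder
    obtain ⟨pr, prmem, prself, prne⟩ := exists_pr g hdecomp
    have htop : ∀ x : L, x ∈ ⨆ p, g p := by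
      intro x; rw [hdecomp.submodule_iSup_eq_top]; trivial
    have prlie : ∀ q, ∀ x ∈ g q, ∀ p a, pr p ⁅a, x⁆ = ⁅pr (p - q) a, x⁆ := by
      intro q x hx p a
      induction htop a using Submodule.iSup_induction' with
      | mem r y hy =>
        by_cases hr : r = p - q
        · subst hr
          rw [prself _ y hy, prself]
          simpa using hgrad _ _ y hy x hx
        · rw [prne r (p - q) hr y hy, prne (r + q) p (by omega) _ (hgrad _ _ y hy x hx), zero_lie]
      | zero => simp
      | add y z _ _ h1 h2 => simp only [add_lie, map_add, h1, h2]
    have prσ : ∀ p x, pr p (σ x) = σ (pr (-p) x) := by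
      intro p x
      induction htop x using Submodule.iSup_induction' with
      | mem r y hy =>
        by_cases hr : r = -p
        · subst hr
          rw [prself _ y hy, prself]
          simpa using hσg _ y hy
        · rw [prne r (-p) hr y hy, prne (-r) p (by omega) _ (hσg _ y hy), map_zero]
      | zero => simp
      | add y z _ _ h1 h2 => simp only [map_add, h1, h2]
    have prsum : ∀ x, x = pr (-2) x + pr (-1) x + pr 0 x + pr 1 x + pr 2 x := by
      intro x
      induction htop x using Submodule.iSup_induction' with
      | mem r y hy =>
        by_cases hr : 2 < |r|
        · rw [hbound r hr, Submodule.mem_bot] at hy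
          simp [hy]
        · have : -2 ≤ r ∧ r ≤ 2 := abs_le.mp (not_lt.mp hr)
          have hcase : r = -2 ∨ r = -1 ∨ r = 0 ∨ r = 1 ∨ r = 2 := by omega
          rcases hcase with rfl | rfl | rfl | rfl | rfl <;>
          · rw [prself _ y hy]
            repeat rw [prne _ _ (by decide) y hy]
            simp
      | zero => simp
      | add y z _ _ h1 h2 =>
        simp only [map_add]
        nth_rewrite 1 [h1, h2]
        abel
    have hzero : ∀ p : ℤ, 2 < |p| → ∀ x ∈ g p, x = 0 := by
      intro p hp x hx
      rwa [hbound p hp, Submodule.mem_bot] at hx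
    -- dual transitivity
    have htrans' : ∀ p : ℤ, p ≤ 0 → ∀ D ∈ g p, (∀ x ∈ g 1, ⁅D, x⁆ = 0) → D = 0 := by
      intro p hp D hD h
      have : σ D = 0 := by
        apply htrans (-p) (by omega) _ (hσg p D hD)
        intro x hx
        have h1 := h (σ x) (by simpa using hσg (-1) x hx)
        have h2 := congrArg σ h1
        rwa [LieHom.map_lie, hσ2, map_zero] at h2
      rw [← hσ2 D, this, map_zero]
    let σl : L →ₗ[ℂ] L := σ
    let P : L →ₗ[ℂ] L := pr (-1) + pr 1
    let f : L →ₗ[ℂ] L := d ∘ₗ pr (-1) + σl ∘ₗ d ∘ₗ σl ∘ₗ pr 1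
    have hP : ∀ x, P x = pr (-1) x + pr 1 x := fun x => rfl
    have hf : ∀ x, f x = d (pr (-1) x) + σ (d (σ (pr 1 x))) := fun x => rfl
    have Pm : ∀ x ∈ g (-1), P x = x := by
      intro x hx
      rw [hP, prself _ x hx, prne _ _ (by decide) x hx, add_zero]
    have Pp : ∀ x ∈ g 1, P x = x := by
      intro x hx
      rw [hP, prself _ x hx, prne _ _ (by decide) x hx, zero_add]
    have fm : ∀ x ∈ g (-1), f x = d x := by
      intro x hx
      rw [hf, prself _ x hx, prne _ _ (by decide) x hx]
      simp
    have fp : ∀ x ∈ g 1, f x = σ (d (σ x)) := by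
      intro x hx
      rw [hf, prself _ x hx, prne _ _ (by decide) x hx]
      simp
    have σp : ∀ x ∈ g 1, σ x ∈ g (-1) := fun x hx => hσg 1 x hx
    have σm : ∀ x ∈ g (-1), σ x ∈ g 1 := fun x hx => by simpa using hσg (-1) x hx
    have fmm : ∀ x ∈ g (-1), f x ∈ g (-1) := fun x hx => by rw [fm x hx]; exact hd x hx
    have fpp : ∀ x ∈ g 1, f x ∈ g 1 := fun x hx => by
      rw [fp x hx]; exact σm _ (hd _ (σp x hx))
    have fσ : ∀ x, f (σ x) = σ (f x) := by
      intro x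
      rw [hf, hf, prσ, prσ, map_add, hσ2, hσ2, neg_neg]
      abel
    have hne1 : ∃ v, P v = v ∧ v ≠ 0 := by
      by_contra hcon
      push Not at hcon
      have hm : ∀ x ∈ g (-1), x = 0 := fun x hx => hcon x (Pm x hx)
      have hnn : ∀ p : ℤ, 0 ≤ p → ∀ x ∈ g p, x = 0 := fun p hp x hx =>
        htrans p hp x hx (fun y hy => by rw [hm y hy, lie_zero])
      have hnp : ∀ p : ℤ, p ≤ 0 → ∀ x ∈ g p, x = 0 := fun p hp x hx =>
        by rw [← hσ2 x, hnn (-p) (by omega) _ (hσg p x hx), map_zero]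
      have hall : ∀ x : L, x = 0 := by
        intro x
        rw [prsum x, hnp _ (by decide) _ (prmem (-2) x), hnp _ (by decide) _ (prmem (-1) x),
          hnp _ (by decide) _ (prmem 0 x), hnn _ (by decide) _ (prmem 1 x),
          hnn _ (by decide) _ (prmem 2 x)]
        simp
      apply LieAlgebra.IsSimple.non_abelian (R := ℂ) (L := L)
      exact ⟨fun x y => hall _⟩
    -- decomposition of odd and even elements
    have odd : ∀ x, P x = x → ∃ a ∈ g (-1), ∃ b ∈ g 1, x = a + b := fun x hx =>
      ⟨_, prmem _ x, _, prmem _ x, by rw [← hP, hx]⟩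
    have even : ∀ x, P x = 0 → pr (-1) x = 0 ∧ pr 1 x = 0 := by
      intro x hx
      have h1 := congrArg (pr (-1)) hx
      have h2 := congrArg (pr 1) hx
      rw [hP, map_add, prself _ _ (prmem _ _), prne 1 (-1) (by decide) _ (prmem _ _)] at h1
      rw [hP, map_add, prself 1 _ (prmem _ _), prne (-1) 1 (by decide) _ (prmem _ _)] at h2
      simpa using And.intro h1 h2
    have pr3 : ∀ p : ℤ, 2 < |p| → ∀ x, pr p x = 0 := fun p hp x => hzero p hp _ (prmem p x)
    have h11 : ∀ x y, P x = x → P y = y → P ⁅x, y⁆ = 0 := by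
      intro x y hx hy
      obtain ⟨a, ha, b, hb, rfl⟩ := odd x hx
      obtain ⟨a', ha', b', hb', rfl⟩ := odd y hy
      simp only [hP, lie_add, map_add, prlie _ _ ha', prlie _ _ hb']
      norm_num
      rw [prne _ _ (by decide) a ha, prne _ _ (by decide) b hb, prne _ _ (by decide) a ha,
        prne _ _ (by decide) b hb, prne _ _ (by decide) a ha, prne _ _ (by decide) b hb]
      simp
    have h01 : ∀ x y, P x = 0 → P y = y → P ⁅x, y⁆ = ⁅x, y⁆ := by
      intro x y hx hy
      obtain ⟨e1, e2⟩ := even x hx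
      obtain ⟨a', ha', b', hb', rfl⟩ := odd y hy
      have k1 : ⁅pr (-2) x, a'⁆ = 0 := hzero (-2 + -1) (by decide) _ (hgrad _ _ _ (prmem _ x) _ ha')
      have k2 : ⁅pr 2 x, b'⁆ = 0 := hzero (2 + 1) (by decide) _ (hgrad _ _ _ (prmem _ x) _ hb')
      simp only [hP, lie_add, map_add, prlie _ _ ha', prlie _ _ hb']
      norm_num
      have q : ∀ y : L, ⁅x, y⁆ = ⁅pr (-2) x, y⁆ + ⁅pr 0 x, y⁆ + ⁅pr 2 x, y⁆ := by
        intro y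
        have := congrArg (fun t => ⁅t, y⁆) (prsum x)
        simp only [e1, e2, add_zero, add_lie] at this
        exact this
      rw [q a', q b', k1, k2]
      abel
    have hfaith : ∀ a, P a = 0 → (∀ x, P x = x → ⁅a, x⁆ = 0) → a = 0 := by
      intro a ha h
      obtain ⟨e1, e2⟩ := even a ha
      have c0 : pr 0 a = 0 := by
        apply htrans 0 le_rfl _ (prmem _ _)
        intro x hx
        have := congrArg (pr (-1)) (h x (Pm x hx))
        rw [prlie _ _ hx] at this
        simpa using this
      have c2 : pr 2 a = 0 := by
        apply htrans 2 (by decide) _ (prmem _ _)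
        intro x hx
        have := congrArg (pr 1) (h x (Pm x hx))
        rw [prlie _ _ hx] at this
        simpa using this
      have c3 : pr (-2) a = 0 := by
        apply htrans' (-2) (by decide) _ (prmem _ _)
        intro x hx
        have := congrArg (pr (-1)) (h x (Pp x hx))
        rw [prlie _ _ hx] at this
        simpa using this
      rw [prsum a, e1, e2, c0, c2, c3]
      simp
    -- the Lie triple derivation property
    let HH : L → L → L → Prop := fun x y z =>
      f ⁅⁅x, y⁆, z⁆ = ⁅⁅f x, y⁆, z⁆ + ⁅⁅x, f y⁆, z⁆ + ⁅⁅x, y⁆, f z⁆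
    have HHσ : ∀ x y z, HH (σ x) (σ y) (σ z) → HH x y z := by
      intro x y z h
      have := congrArg σ h
      simp only [fσ, ← LieHom.map_lie, ← map_add, hσ2] at this
      exact this
    have Hswap : ∀ x y z, HH x y z → HH y x z := by
      intro x y z h
      change _ = _ at h ⊢
      rw [← lie_skew y x, ← lie_skew (f y) x, ← lie_skew y (f x)]
      simp only [neg_lie, map_neg]
      rw [h]
      abel
    have Hmpm : ∀ x ∈ g (-1), ∀ u ∈ g 1, ∀ z ∈ g (-1), HH x u z := by
      intro x hx u hu z hz
      have h := hder x hx (σ u) (σp u hu) z hz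
      unfold trip at h
      rw [hσ2] at h
      change _ = _
      rw [fm x hx, fm z hz, fp u hu, fm _ _, h]
      have := hgrad _ _ _ (hgrad _ _ x hx u hu) z hz
      simpa using this
    have Hmmp : ∀ x ∈ g (-1), ∀ y ∈ g (-1), ∀ u ∈ g 1, HH x y u := by
      intro x hx y hy u hu
      have h1 := Hmpm x hx u hu y hy
      have h2 := Hmpm y hy u hu x hx
      change _ = _ at h1 h2 ⊢
      have J : ∀ a b c : L, ⁅⁅a, b⁆, c⁆ = ⁅⁅a, c⁆, b⁆ - ⁅⁅b, c⁆, a⁆ := by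
        intro a b c
        rw [lie_lie, ← lie_skew a ⁅b, c⁆, ← lie_skew b ⁅a, c⁆]
        abel
      rw [J x y u, J (f x) y u, J x (f y) u, J x y (f u), map_sub, h1, h2]
      abel
    have Hmmm : ∀ x ∈ g (-1), ∀ y ∈ g (-1), ∀ z ∈ g (-1), HH x y z := by
      have k : ∀ x ∈ g (-1), ∀ y ∈ g (-1), ∀ z ∈ g (-1), ⁅⁅x, y⁆, z⁆ = 0 :=
        fun x hx y hy z hz => hzero (-1 + -1 + -1) (by decide) _ (hgrad _ _ _ (hgrad _ _ x hx y hy) z hz)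
      intro x hx y hy z hz
      change _ = _
      rw [k x hx y hy z hz, k _ (fmm x hx) y hy z hz, k x hx _ (fmm y hy) z hz,
        k x hx y hy _ (fmm z hz)]
      simp
    have H : ∀ x y z, P x = x → P y = y → P z = z → HH x y z := by
      intro x y z hx0 hy0 hz0
      obtain ⟨x, hx, x', hx', rfl⟩ := odd x hx0
      obtain ⟨y, hy, y', hy', rfl⟩ := odd y hy0
      obtain ⟨z, hz, z', hz', rfl⟩ := odd z hz0
      have t1 := Hmmm x hx y hy z hz
      have t2 := Hmmp x hx y hy z' hz'
      have t3 := Hmpm x hx y' hy' z hz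
      have t4 := Hswap _ _ _ (Hmpm y hy x' hx' z hz)
      have t5 := HHσ _ _ _ (Hmmm _ (σp x' hx') _ (σp y' hy') _ (σp z' hz'))
      have t6 := HHσ _ _ _ (Hmmp _ (σp x' hx') _ (σp y' hy') _ (σm z hz))
      have t7 := HHσ _ _ _ (Hmpm _ (σp x' hx') _ (σm y hy) _ (σp z' hz'))
      have t8 := HHσ _ _ _ (Hswap _ _ _ (Hmpm _ (σp y' hy') _ (σm x hx) _ (σp z' hz')))
      change _ = _ at t1 t2 t3 t4 t5 t6 t7 t8 ⊢
      simp only [add_lie, lie_add, map_add, t1, t2, t3, t4, t5, t6, t7, t8]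
      abel
    have hPf : ∀ x, P (f x) = f x := by
      intro x
      rw [hf, map_add, Pm _ (hd _ (prmem _ x)), Pp _ (σm _ (hd _ (σp _ (prmem _ x))))]
    have hfP : ∀ x, f (P x) = f x := by
      intro x
      rw [hP, map_add, fm _ (prmem _ x), fp _ (prmem _ x), hf]
    have hPP : ∀ x, P (P x) = P x := by
      intro x
      rw [hP x, map_add, Pm _ (prmem _ x), Pp _ (prmem _ x)]
    obtain ⟨X, hX⟩ := z2_ext P f hPP h11 h01 hne1 hfaith hPf hfP H
    have D1 : ∀ x ∈ g (-1), d x = ⁅pr 0 X, x⁆ := by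
      intro x hx
      have := congrArg (pr (-1)) (hX x (Pm x hx))
      rw [prlie _ _ hx, fm x hx, prself _ _ (hd x hx)] at this
      simpa using this
    have D2 : ∀ x ∈ g 1, f x = ⁅pr 0 X, x⁆ := by
      intro x hx
      have := congrArg (pr 1) (hX x (Pp x hx))
      rw [prlie _ _ hx, prself _ _ (fpp x hx)] at this
      simpa using this
    have uniq : ∀ D ∈ g 0, ∀ D' ∈ g 0, (∀ x ∈ g (-1), ⁅D, x⁆ = ⁅D', x⁆) → D = D' := by
      intro D hD D' hD' h
      rw [← sub_eq_zero]
      apply htrans 0 le_rfl _ (sub_mem hD hD')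
      intro x hx
      rw [sub_lie, h x hx, sub_self]
    refine ⟨pr 0 X, ⟨prmem _ _, ?_, D1⟩, ?_⟩
    · apply uniq _ (by simpa using hσg 0 _ (prmem 0 X)) _ (prmem _ _)
      intro x hx
      rw [← D1 x hx]
      have h := D2 (σ x) (σm x hx)
      rw [fσ, fm x hx] at h
      have h' := congrArg σ h
      rw [hσ2, LieHom.map_lie, hσ2] at h'
      exact h'.symm
    · rintro D' ⟨hD', _, h⟩
      apply uniq _ hD' _ (prmem _ _)
      intro x hx
      rw [← h x hx, D1 x hx]
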